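/- arXiv:1811.09219 — 2 statements merged into one kernel-verified Lean document; each statement's English description precedes it below -/
import Mathlib

section
/- Let q1, q2 ∈ (0,1), n ∈ ℕ, and t > 0. Then there exist real numbers μ > 0 and ν > 0 satisfying μ = q1^t·(1 + q2^t + q2^{2t} + … + q2^{nt})·μ + q1^t·q2^{nt}·ν and ν = q2^t·μ + q2^t·ν, if and only if q1^t + q2^t = 1. -/
open Finset

/-- For `q₁, q₂ ∈ (0,1)`, `n ∈ ℕ` and `t > 0`, there exist `μ, ν > 0` with
`μ = q₁^t (1 + q₂^t + … + q₂^{nt}) μ + q₁^t q₂^{nt} ν` and `ν = q₂^t μ + q₂^t ν`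
if and only if `q₁^t + q₂^t = 1`. -/
theorem mauldin_williams_equation (q₁ q₂ : ℝ) (hq₁ : q₁ ∈ Set.Ioo (0:ℝ) 1)
    (hq₂ : q₂ ∈ Set.Ioo (0:ℝ) 1) (n : ℕ) (t : ℝ) (ht : 0 < t) :
    (∃ μ ν : ℝ, 0 < μ ∧ 0 < ν ∧
      μ = q₁ ^ t * (∑ k ∈ Finset.range (n + 1), q₂ ^ ((k : ℝ) * t)) * μ
            + q₁ ^ t * q₂ ^ ((n : ℝ) * t) * ν ∧
      ν = q₂ ^ t * μ + q₂ ^ t * ν) ↔ q₁ ^ t + q₂ ^ t = 1 := by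
  have hb0 : 0 < q₂ ^ t := Real.rpow_pos_of_pos hq₂.1 t
  have ha0 : 0 < q₁ ^ t := Real.rpow_pos_of_pos hq₁.1 t
  have hpow (k : ℕ) : q₂ ^ ((k : ℝ) * t) = (q₂ ^ t) ^ k := by
    rw [mul_comm, Real.rpow_mul_natCast hq₂.1.le]
  simp only [hpow]
  have hS := geom_sum_mul_neg (q₂ ^ t) (n + 1)
  generalize q₁ ^ t = a at *
  generalize q₂ ^ t = b at *
  generalize ∑ k ∈ Finset.range (n + 1), b ^ k = S at *
  rw [pow_succ] at hS
  constructor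
  · rintro ⟨μ, ν, hμ, -, h₁, h₂⟩
    apply mul_right_cancel₀ hμ.ne'
    linear_combination (b - 1) * h₁ - a * b ^ n * h₂ - a * μ * hS
  · intro h
    obtain rfl : a = 1 - b := by linarith
    exact ⟨1 - b, b, ha0, hb0, by linear_combination (b - 1) * hS, by ring⟩
end

section
/- Let p1 > 0, p2 > 0 with p1 + p2 < 1. There exists a unique increasing homeomorphism φ : [0,1] → [0,1] such that for all x ∈ [0,1]: φ(p1·x) = φ(x)/3, φ(p1 + (1 − p1 − p2)·x) = (1 + φ(x))/3, and φ(1 − p2 + p2·x) = (2 + φ(x))/3. This φ is an isomorphism of the linear zipper with vertices {0, p1, 1 − p2, 1} onto the zipper with vertices {0, 1/3, 2/3, 1}; in particular φ(0) = 0 and φ(1) = 1, and φ maps the attractor of the system {x ↦ p1·x, x ↦ p2·x + 1 − p2} on [0,1] onto the standard middle-thirds Cantor set, preserving addresses. -/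
open Set

/-- `f` intertwines the linear zipper on `[0, 1]` with vertices `0, a, b, 1` and the one with
vertices `0, c, d, 1`. -/
def IntertwinesZippers (a b c d : ℝ) (f : ℝ → ℝ) : Prop :=
  ∀ x ∈ Icc (0 : ℝ) 1,
    f (a * x) = c * f x ∧ f (a + (b - a) * x) = c + (d - c) * f x ∧
      f (b + (1 - b) * x) = d + (1 - d) * f x

/-- The bounded continuous functions `ℝ → [0, 1]` that vanish on `(-∞, 0]` and are `1` on
`[1, ∞)`. -/
def boundedTransition : Set (BoundedContinuousFunction ℝ ℝ) :=
  {f | ∀ x, 0 ≤ f x ∧ f x ≤ 1 ∧ (x ≤ 0 → f x = 0) ∧ (1 ≤ x → f x = 1)}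

theorem isClosed_boundedTransition : IsClosed boundedTransition := by
  have h (x : ℝ) : Continuous fun f : BoundedContinuousFunction ℝ ℝ => f x :=
    continuous_eval_const x
  simp only [boundedTransition, ofPred_forall, ofPred_and]
  refine isClosed_iInter fun x => ((isClosed_le continuous_const (h x)).inter
    ((isClosed_le (h x) continuous_const).inter (IsClosed.inter ?_ ?_)))
  · exact isClosed_iInter fun _ => isClosed_eq (h x) continuous_const
  · exact isClosed_iInter fun _ => isClosed_eq (h x) continuous_const

theorem boundedTransition_nonempty : boundedTransition.Nonempty := by
  refine ⟨BoundedContinuousFunction.ofNormedAddCommGroup (fun x : ℝ => max 0 (min x 1))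
    (by fun_prop) 1 fun x => ?_, fun x => ?_⟩
  · rw [Real.norm_eq_abs, abs_le]
    exact ⟨by linarith [le_max_left 0 (min x 1)], max_le zero_le_one (min_le_right _ _)⟩
  · refine ⟨le_max_left _ _, max_le zero_le_one (min_le_right _ _), fun hx => ?_, fun hx => ?_⟩
    · exact max_eq_left ((min_le_left _ _).trans hx)
    · simp [hx]

/-- The transfer operator whose fixed points in `boundedTransition` intertwine the zippers with
vertices `0, a, b, 1` and `0, c, d, 1`. -/
noncomputable def zipperOperator (a b c d : ℝ) (f : BoundedContinuousFunction ℝ ℝ) :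
    BoundedContinuousFunction ℝ ℝ :=
  c • f.compContinuous ⟨fun x => x / a, by fun_prop⟩ +
    (d - c) • f.compContinuous ⟨fun x => (x - a) / (b - a), by fun_prop⟩ +
    (1 - d) • f.compContinuous ⟨fun x => (x - b) / (1 - b), by fun_prop⟩

theorem zipperOperator_apply (a b c d : ℝ) (f : BoundedContinuousFunction ℝ ℝ) (x : ℝ) :
    zipperOperator a b c d f x =
      c * f (x / a) + (d - c) * f ((x - a) / (b - a)) + (1 - d) * f ((x - b) / (1 - b)) := rfl

section

variable {a b c d : ℝ}

theorem zipperOperator_apply_of_le_left (hab : a < b) (hb : b < 1)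
    {f : BoundedContinuousFunction ℝ ℝ} (hf : f ∈ boundedTransition) {x : ℝ} (hx : x ≤ a) :
    zipperOperator a b c d f x = c * f (x / a) := by
  rw [zipperOperator_apply,
    (hf _).2.2.1 (div_nonpos_of_nonpos_of_nonneg (sub_nonpos.2 hx) (by linarith)),
    (hf _).2.2.1 (div_nonpos_of_nonpos_of_nonneg (a := x - b) (by linarith) (by linarith))]
  ring

theorem zipperOperator_apply_of_mem_Icc (ha : 0 < a) (hb : b < 1)
    {f : BoundedContinuousFunction ℝ ℝ} (hf : f ∈ boundedTransition) {x : ℝ}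
    (hx : x ∈ Icc a b) :
    zipperOperator a b c d f x = c + (d - c) * f ((x - a) / (b - a)) := by
  rw [zipperOperator_apply, (hf _).2.2.2 ((one_le_div ha).2 hx.1),
    (hf _).2.2.1 (div_nonpos_of_nonpos_of_nonneg (sub_nonpos.2 hx.2) (by linarith))]
  ring

theorem zipperOperator_apply_of_le_right (ha : 0 < a) (hab : a < b)
    {f : BoundedContinuousFunction ℝ ℝ} (hf : f ∈ boundedTransition) {x : ℝ} (hx : b ≤ x) :
    zipperOperator a b c d f x = d + (1 - d) * f ((x - b) / (1 - b)) := by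
  rw [zipperOperator_apply, (hf _).2.2.2 ((one_le_div ha).2 (by linarith)),
    (hf _).2.2.2 ((one_le_div (sub_pos.2 hab)).2 (by linarith))]
  ring

theorem mapsTo_zipperOperator (ha : 0 < a) (hab : a < b) (hb : b < 1) (hc : 0 < c)
    (hcd : c < d) (hd : d < 1) :
    MapsTo (zipperOperator a b c d) boundedTransition boundedTransition := by
  intro f hf x
  refine ⟨?_, ?_, fun hx => ?_, fun hx => ?_⟩
  · rw [zipperOperator_apply]
    have := mul_nonneg hc.le (hf (x / a)).1
    have := mul_nonneg (sub_pos.2 hcd).le (hf ((x - a) / (b - a))).1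
    have := mul_nonneg (sub_pos.2 hd).le (hf ((x - b) / (1 - b))).1
    linarith
  · rw [zipperOperator_apply]
    have := mul_le_of_le_one_right hc.le (hf (x / a)).2.1
    have := mul_le_of_le_one_right (sub_pos.2 hcd).le (hf ((x - a) / (b - a))).2.1
    have := mul_le_of_le_one_right (sub_pos.2 hd).le (hf ((x - b) / (1 - b))).2.1
    linarith
  · rw [zipperOperator_apply_of_le_left hab hb hf (by linarith),
      (hf _).2.2.1 (div_nonpos_of_nonpos_of_nonneg hx ha.le), mul_zero]
  · rw [zipperOperator_apply_of_le_right ha hab hf (by linarith),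
      (hf _).2.2.2 ((one_le_div (sub_pos.2 hb)).2 (by linarith))]
    ring

theorem dist_zipperOperator_le (ha : 0 < a) (hab : a < b) (hb : b < 1) {r : ℝ} (hc : 0 < c)
    (hcd : c < d) (hd : d < 1) (hcr : c ≤ r) (hdcr : d - c ≤ r) (hdr : 1 - d ≤ r)
    {f g : BoundedContinuousFunction ℝ ℝ} (hf : f ∈ boundedTransition)
    (hg : g ∈ boundedTransition) :
    dist (zipperOperator a b c d f) (zipperOperator a b c d g) ≤ r * dist f g := by
  have key (s y : ℝ) (hs : 0 < s) (hsr : s ≤ r) : |s * f y - s * g y| ≤ r * dist f g := by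
    rw [← mul_sub, abs_mul, abs_of_pos hs]
    exact mul_le_mul hsr ((Real.dist_eq _ _).symm.trans_le (f.dist_coe_le_dist y))
      (abs_nonneg _) (hs.le.trans hsr)
  have hr : 0 ≤ r := hc.le.trans hcr
  refine (BoundedContinuousFunction.dist_le (by positivity)).2 fun x => ?_
  rw [Real.dist_eq]
  rcases le_total x a with hxa | hax
  · rw [zipperOperator_apply_of_le_left hab hb hf hxa,
      zipperOperator_apply_of_le_left hab hb hg hxa]
    exact key _ _ hc hcr
  rcases le_total x b with hxb | hbx
  · rw [zipperOperator_apply_of_mem_Icc ha hb hf ⟨hax, hxb⟩,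
      zipperOperator_apply_of_mem_Icc ha hb hg ⟨hax, hxb⟩, add_sub_add_left_eq_sub]
    exact key _ _ (sub_pos.2 hcd) hdcr
  · rw [zipperOperator_apply_of_le_right ha hab hf hbx,
      zipperOperator_apply_of_le_right ha hab hg hbx, add_sub_add_left_eq_sub]
    exact key _ _ (sub_pos.2 hd) hdr

theorem exists_ratio_bound (hc : 0 < c) (hcd : c < d) (hd : d < 1) :
    ∃ r : ℝ, 0 ≤ r ∧ r < 1 ∧ c ≤ r ∧ d - c ≤ r ∧ 1 - d ≤ r :=
  ⟨max c (max (d - c) (1 - d)), le_max_of_le_left hc.le,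
    max_lt (hcd.trans hd) (max_lt (by linarith) (by linarith)), le_max_left _ _,
    le_max_of_le_right (le_max_left _ _), le_max_of_le_right (le_max_right _ _)⟩

theorem exists_intertwinesZippers (ha : 0 < a) (hab : a < b) (hb : b < 1) (hc : 0 < c)
    (hcd : c < d) (hd : d < 1) :
    ∃ f : ℝ → ℝ, Continuous f ∧ MapsTo f (Icc 0 1) (Icc 0 1) ∧ f 0 = 0 ∧ f 1 = 1 ∧
      IntertwinesZippers a b c d f := by
  obtain ⟨r, hr, hr1, hcr, hdcr, hdr⟩ := exists_ratio_bound hc hcd hd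
  have hmaps := mapsTo_zipperOperator ha hab hb hc hcd hd
  have hcontr : ContractingWith ⟨r, hr⟩ (hmaps.restrict _ _ _) :=
    ⟨hr1, LipschitzWith.of_dist_le_mul fun f g =>
      dist_zipperOperator_le ha hab hb hc hcd hd hcr hdcr hdr f.2 g.2⟩
  obtain ⟨g, hg⟩ := boundedTransition_nonempty
  obtain ⟨f, hf, hfix, -⟩ := ContractingWith.exists_fixedPoint'
    isClosed_boundedTransition.isComplete hmaps hcontr hg (edist_ne_top _ _)
  have hfix' (x : ℝ) : f x = zipperOperator a b c d f x := by rw [hfix]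
  refine ⟨f, f.continuous, fun x _ => ⟨(hf x).1, (hf x).2.1⟩, (hf 0).2.2.1 le_rfl,
    (hf 1).2.2.2 le_rfl, fun x hx => ⟨?_, ?_, ?_⟩⟩
  · rw [hfix', zipperOperator_apply_of_le_left hab hb hf (by nlinarith [hx.2]),
      mul_div_cancel_left₀ _ ha.ne']
  · rw [hfix', zipperOperator_apply_of_mem_Icc ha hb hf
        ⟨by nlinarith [hx.1], by nlinarith [hx.2]⟩,
      add_sub_cancel_left, mul_div_cancel_left₀ _ (sub_pos.2 hab).ne']
  · rw [hfix', zipperOperator_apply_of_le_right ha hab hf (by nlinarith [hx.1]),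
      add_sub_cancel_left, mul_div_cancel_left₀ _ (sub_pos.2 hb).ne']

theorem IntertwinesZippers.eqOn (ha : 0 < a) (hab : a < b) (hb : b < 1) (hc : 0 < c)
    (hcd : c < d) (hd : d < 1) {f g : ℝ → ℝ} (hf : IntertwinesZippers a b c d f)
    (hg : IntertwinesZippers a b c d g) (hfm : MapsTo f (Icc 0 1) (Icc 0 1))
    (hgm : MapsTo g (Icc 0 1) (Icc 0 1)) : EqOn f g (Icc 0 1) := by
  obtain ⟨r, hr, hr1, hcr, hdcr, hdr⟩ := exists_ratio_bound hc hcd hd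
  have key (n : ℕ) : ∀ x ∈ Icc (0 : ℝ) 1, |f x - g x| ≤ r ^ n := by
    induction n with
    | zero =>
      intro x hx
      rw [pow_zero, abs_le]
      constructor <;> linarith [(hfm hx).1, (hfm hx).2, (hgm hx).1, (hgm hx).2]
    | succ n ih =>
      have step (s y : ℝ) (hs : 0 < s) (hsr : s ≤ r) (hy : y ∈ Icc (0 : ℝ) 1) :
          |s * f y - s * g y| ≤ r ^ (n + 1) := by
        rw [← mul_sub, abs_mul, abs_of_pos hs, pow_succ']
        exact mul_le_mul hsr (ih y hy) (abs_nonneg _) hr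
      intro x hx
      rcases le_total x a with hxa | hax
      · have hy : x / a ∈ Icc (0 : ℝ) 1 := ⟨div_nonneg hx.1 ha.le, (div_le_one ha).2 hxa⟩
        rw [← mul_div_cancel₀ x ha.ne', (hf _ hy).1, (hg _ hy).1]
        exact step _ _ hc hcr hy
      rcases le_total x b with hxb | hbx
      · have hba := sub_pos.2 hab
        have hy : (x - a) / (b - a) ∈ Icc (0 : ℝ) 1 :=
          ⟨div_nonneg (by linarith) hba.le, (div_le_one hba).2 (by linarith)⟩
        have hxy : x = a + (b - a) * ((x - a) / (b - a)) := by
          rw [mul_div_cancel₀ _ hba.ne', add_sub_cancel]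
        rw [hxy, (hf _ hy).2.1, (hg _ hy).2.1, add_sub_add_left_eq_sub]
        exact step _ _ (sub_pos.2 hcd) hdcr hy
      · have hb' := sub_pos.2 hb
        have hy : (x - b) / (1 - b) ∈ Icc (0 : ℝ) 1 :=
          ⟨div_nonneg (by linarith) hb'.le, (div_le_one hb').2 (by linarith [hx.2])⟩
        have hxy : x = b + (1 - b) * ((x - b) / (1 - b)) := by
          rw [mul_div_cancel₀ _ hb'.ne', add_sub_cancel]
        rw [hxy, (hf _ hy).2.2, (hg _ hy).2.2, add_sub_add_left_eq_sub]
        exact step _ _ (sub_pos.2 hd) hdr hy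
  intro x hx
  have h0 := ge_of_tendsto' (tendsto_pow_atTop_nhds_zero_of_lt_one hr hr1) fun n => key n x hx
  exact sub_eq_zero.1 (abs_nonpos_iff.1 h0)

theorem IntertwinesZippers.comp {a' b' : ℝ} {f g : ℝ → ℝ}
    (hg : IntertwinesZippers a' b' c d g) (hf : IntertwinesZippers a b a' b' f)
    (hfm : MapsTo f (Icc 0 1) (Icc 0 1)) : IntertwinesZippers a b c d (g ∘ f) := by
  intro x hx
  simp only [Function.comp_apply, (hf x hx).1, (hf x hx).2.1, (hf x hx).2.2]
  exact hg _ (hfm hx)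

theorem intertwinesZippers_id (a b : ℝ) : IntertwinesZippers a b a b id :=
  fun _ _ => ⟨rfl, rfl, rfl⟩

theorem exists_strictMonoOn_intertwinesZippers (ha : 0 < a) (hab : a < b) (hb : b < 1)
    (hc : 0 < c) (hcd : c < d) (hd : d < 1) :
    ∃ f : ℝ → ℝ, ContinuousOn f (Icc 0 1) ∧ StrictMonoOn f (Icc 0 1) ∧
      f '' Icc 0 1 = Icc 0 1 ∧ f 0 = 0 ∧ f 1 = 1 ∧ IntertwinesZippers a b c d f := by
  obtain ⟨f, hfc, hfm, hf0, hf1, hf⟩ := exists_intertwinesZippers ha hab hb hc hcd hd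
  obtain ⟨g, -, hgm, -, -, hg⟩ := exists_intertwinesZippers hc hcd hd ha hab hb
  have hgf : LeftInvOn g f (Icc 0 1) := (hg.comp hf hfm).eqOn ha hab hb ha hab hb
    (intertwinesZippers_id a b) (hgm.comp hfm) (mapsTo_id _)
  have hfg : LeftInvOn f g (Icc 0 1) := (hf.comp hg hgm).eqOn hc hcd hd hc hcd hd
    (intertwinesZippers_id c d) (hfm.comp hgm) (mapsTo_id _)
  exact ⟨f, hfc.continuousOn, hfc.continuousOn.strictMonoOn_of_injOn_Icc zero_le_one
    (by rw [hf0, hf1]; exact zero_le_one) hgf.injOn, (hfg.surjOn hgm).image_eq_of_mapsTo hfm,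
    hf0, hf1, hf⟩

end

theorem cantor_attractor_subset {A B : Set ℝ} (hA : A ⊆ Icc 0 1) (hB : B ⊆ Icc 0 1)
    (hBne : B.Nonempty) (hBc : IsCompact B)
    (hAeq : A ⊆ (fun x : ℝ => x / 3) '' A ∪ (fun x : ℝ => (x + 2) / 3) '' A)
    (hBeq : (fun x : ℝ => x / 3) '' B ∪ (fun x : ℝ => (x + 2) / 3) '' B ⊆ B) : A ⊆ B := by
  have key (n : ℕ) : ∀ x ∈ A, ∃ y ∈ B, |x - y| ≤ (1 / 3 : ℝ) ^ n := by
    induction n with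
    | zero =>
      intro x hx
      obtain ⟨y, hy⟩ := hBne
      refine ⟨y, hy, ?_⟩
      rw [pow_zero, abs_le]
      constructor <;> linarith [(hA hx).1, (hA hx).2, (hB hy).1, (hB hy).2]
    | succ n ih =>
      intro x hx
      rcases hAeq hx with ⟨z, hz, rfl⟩ | ⟨z, hz, rfl⟩
      all_goals
        obtain ⟨y, hy, hzy⟩ := ih z hz
        rw [abs_le] at hzy
      · refine ⟨y / 3, hBeq (Or.inl ⟨y, hy, rfl⟩), ?_⟩
        rw [pow_succ, abs_le]
        constructor <;> linarith
      · refine ⟨(y + 2) / 3, hBeq (Or.inr ⟨y, hy, rfl⟩), ?_⟩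
        rw [pow_succ, abs_le]
        constructor <;> linarith
  intro x hx
  rw [← hBc.isClosed.closure_eq, Metric.mem_closure_iff]
  intro ε hε
  obtain ⟨n, hn⟩ := exists_pow_lt_of_lt_one hε (by norm_num : (1 / 3 : ℝ) < 1)
  obtain ⟨y, hy, hxy⟩ := key n x hx
  exact ⟨y, hy, hxy.trans_lt hn⟩

/-- For `p₁, p₂ > 0` with `p₁ + p₂ < 1` there is a unique increasing
homeomorphism `φ : [0,1] → [0,1]` conjugating the zipper with vertices `{0, p₁, 1 − p₂, 1}`
to the zipper with vertices `{0, 1/3, 2/3, 1}`; in particular `φ(0) = 0`, `φ(1) = 1`, and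
`φ` maps the attractor of `{x ↦ p₁x, x ↦ p₂x + 1 − p₂}` onto the middle-thirds Cantor set,
preserving addresses (via the three functional equations). -/
theorem zipper_isomorphism (p₁ p₂ : ℝ) (h₁ : 0 < p₁) (h₂ : 0 < p₂) (h : p₁ + p₂ < 1)
    (E C : Set ℝ)
    (hE : E.Nonempty ∧ IsCompact E ∧ E ⊆ Icc 0 1 ∧
      E = (fun x : ℝ => p₁ * x) '' E ∪ (fun x : ℝ => p₂ * x + 1 - p₂) '' E)
    (hC : C.Nonempty ∧ IsCompact C ∧ C ⊆ Icc 0 1 ∧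
      C = (fun x : ℝ => x / 3) '' C ∪ (fun x : ℝ => (x + 2) / 3) '' C) :
    ∃ φ : ℝ → ℝ,
      (ContinuousOn φ (Icc 0 1) ∧ StrictMonoOn φ (Icc 0 1) ∧ φ '' Icc 0 1 = Icc 0 1 ∧
        ∀ x ∈ Icc (0:ℝ) 1,
          φ (p₁ * x) = φ x / 3 ∧
          φ (p₁ + (1 - p₁ - p₂) * x) = (1 + φ x) / 3 ∧
          φ (1 - p₂ + p₂ * x) = (2 + φ x) / 3) ∧
      (∀ ψ : ℝ → ℝ,
        (ContinuousOn ψ (Icc 0 1) ∧ StrictMonoOn ψ (Icc 0 1) ∧ ψ '' Icc 0 1 = Icc 0 1 ∧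
          ∀ x ∈ Icc (0:ℝ) 1,
            ψ (p₁ * x) = ψ x / 3 ∧
            ψ (p₁ + (1 - p₁ - p₂) * x) = (1 + ψ x) / 3 ∧
            ψ (1 - p₂ + p₂ * x) = (2 + ψ x) / 3) → Set.EqOn φ ψ (Icc 0 1)) ∧
      φ 0 = 0 ∧ φ 1 = 1 ∧ φ '' E = C := by
  have hiff (f : ℝ → ℝ) : IntertwinesZippers p₁ (1 - p₂) (1 / 3) (2 / 3) f ↔
      ∀ x ∈ Icc (0:ℝ) 1,
          f (p₁ * x) = f x / 3 ∧
          f (p₁ + (1 - p₁ - p₂) * x) = (1 + f x) / 3 ∧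
          f (1 - p₂ + p₂ * x) = (2 + f x) / 3 := by
    refine forall₂_congr fun x _ => ?_
    rw [sub_sub_cancel, sub_right_comm 1 p₂ p₁]
    ring_nf
  have hab : p₁ < 1 - p₂ := by linarith
  have hb : 1 - p₂ < 1 := by linarith
  obtain ⟨φ, hφc, hφmono, hφim, hφ0, hφ1, hφ⟩ := exists_strictMonoOn_intertwinesZippers
    (c := 1 / 3) (d := 2 / 3) h₁ hab hb (by norm_num) (by norm_num) (by norm_num)
  have hφm := mapsTo_iff_image_subset.2 hφim.subset
  have hφ' := (hiff φ).1 hφ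
  refine ⟨φ, ⟨hφc, hφmono, hφim, hφ'⟩, ?_, hφ0, hφ1, ?_⟩
  · rintro ψ ⟨-, -, hψim, hψ⟩
    exact hφ.eqOn h₁ hab hb (by norm_num) (by norm_num) (by norm_num) ((hiff ψ).2 hψ) hφm
      (mapsTo_iff_image_subset.2 hψim.subset)
  · obtain ⟨hEne, hEc, hEI, hEeq⟩ := hE
    obtain ⟨hCne, hCc, hCI, hCeq⟩ := hC
    have himage : φ '' E =
        (fun x : ℝ => x / 3) '' (φ '' E) ∪ (fun x : ℝ => (x + 2) / 3) '' (φ '' E) := by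
      conv_lhs => rw [hEeq]
      simp only [image_union, image_image]
      congr 1
      · exact image_congr fun x hx => (hφ' x (hEI hx)).1
      · refine image_congr fun x hx => ?_
        rw [show p₂ * x + 1 - p₂ = 1 - p₂ + p₂ * x by ring, (hφ' x (hEI hx)).2.2, add_comm]
    have hφEI : φ '' E ⊆ Icc 0 1 := (hφm.mono_left hEI).image_subset
    have hφEc : IsCompact (φ '' E) := hEc.image_of_continuousOn (hφc.mono hEI)
    exact (cantor_attractor_subset hφEI hCI hCne hCc himage.subset hCeq.superset).antisymm
      (cantor_attractor_subset hCI hφEI (hEne.image φ) hφEc hCeq.subset himage.superset)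
end
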